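/- arXiv:1807.07063 — 5 statements merged into one kernel-verified Lean document; each statement's English description precedes it below -/
import Mathlib

section
/- Momentum equation for the first explicit family: let T* > 0, ν ≥ 0, k ≠ 0, ā ≠ 0, and a ∈ ℝ with a ∉ {−1/2, 0}. Define, for 0 ≤ t < T* and x ∈ ℝ³ with x₁² + x₂² ≠ 0: v(t,x) = (a x₁/(T*−t) + k x₂/(x₁²+x₂²), a x₂/(T*−t) − k x₁/(x₁²+x₂²), −2a x₃/(T*−t)), H(t,x) = (ā x₁ + 2āk x₂(T*−t)/((2a+1)(x₁²+x₂²)), ā x₂ − 2āk x₁(T*−t)/((2a+1)(x₁²+x₂²)), −2ā x₃), and P(t,x) = −(1/2)(a(a+1)(x₁²+x₂²)/(T*−t)² + k²/(x₁²+x₂²)) + a(1−2a) x₃²/(T*−t)². Then at every such point ∂ₜv + (v·∇)v + ∇P = νΔv + (∇×H)×H. -/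
set_option linter.unusedVariables false

open Real Filter

noncomputable section

/-- Scalar fields on spacetime, in curried form `f t x₁ x₂ x₃`. -/
abbrev F : Type := ℝ → ℝ → ℝ → ℝ → ℝ

/-- Time partial derivative `∂ₜ`. -/
def pdt (f : F) : F := fun t x1 x2 x3 => deriv (fun s => f s x1 x2 x3) t

/-- Spatial partial derivative `∂_{x₁}`. -/
def pd1 (f : F) : F := fun t x1 x2 x3 => deriv (fun y => f t y x2 x3) x1

/-- Spatial partial derivative `∂_{x₂}`. -/
def pd2 (f : F) : F := fun t x1 x2 x3 => deriv (fun y => f t x1 y x3) x2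

/-- Spatial partial derivative `∂_{x₃}`. -/
def pd3 (f : F) : F := fun t x1 x2 x3 => deriv (fun y => f t x1 x2 y) x3

/-- Spatial Laplacian `Δ = ∂₁² + ∂₂² + ∂₃²`. -/
def lap (f : F) : F := fun t x1 x2 x3 =>
  pd1 (pd1 f) t x1 x2 x3 + pd2 (pd2 f) t x1 x2 x3 + pd3 (pd3 f) t x1 x2 x3

/-- Spatial divergence `∇·u` of a vector field `u = (u1, u2, u3)`. -/
def divg (u1 u2 u3 : F) : F := fun t x1 x2 x3 =>
  pd1 u1 t x1 x2 x3 + pd2 u2 t x1 x2 x3 + pd3 u3 t x1 x2 x3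

/-- First component of the spatial curl `∇×u`. -/
def curl1 (u1 u2 u3 : F) : F := fun t x1 x2 x3 => pd2 u3 t x1 x2 x3 - pd3 u2 t x1 x2 x3

/-- Second component of the spatial curl `∇×u`. -/
def curl2 (u1 u2 u3 : F) : F := fun t x1 x2 x3 => pd3 u1 t x1 x2 x3 - pd1 u3 t x1 x2 x3

/-- Third component of the spatial curl `∇×u`. -/
def curl3 (u1 u2 u3 : F) : F := fun t x1 x2 x3 => pd1 u2 t x1 x2 x3 - pd2 u1 t x1 x2 x3

/-- First component of the pointwise cross product `a × b`. -/
def cr1 (a1 a2 a3 b1 b2 b3 : F) : F := fun t x1 x2 x3 =>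
  a2 t x1 x2 x3 * b3 t x1 x2 x3 - a3 t x1 x2 x3 * b2 t x1 x2 x3

/-- Second component of the pointwise cross product `a × b`. -/
def cr2 (a1 a2 a3 b1 b2 b3 : F) : F := fun t x1 x2 x3 =>
  a3 t x1 x2 x3 * b1 t x1 x2 x3 - a1 t x1 x2 x3 * b3 t x1 x2 x3

/-- Third component of the pointwise cross product `a × b`. -/
def cr3 (a1 a2 a3 b1 b2 b3 : F) : F := fun t x1 x2 x3 =>
  a1 t x1 x2 x3 * b2 t x1 x2 x3 - a2 t x1 x2 x3 * b1 t x1 x2 x3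

/-- The momentum equation `∂ₜv + (v·∇)v + ∇P = ν Δv + (∇×H)×H` of the 3D incompressible
MHD system with viscosity `ν`, at the point `(t, x1, x2, x3)` (all three components). -/
def momEq (ν : ℝ) (v1 v2 v3 H1 H2 H3 P : F) (t x1 x2 x3 : ℝ) : Prop :=
  (pdt v1 t x1 x2 x3 + v1 t x1 x2 x3 * pd1 v1 t x1 x2 x3 + v2 t x1 x2 x3 * pd2 v1 t x1 x2 x3 +
      v3 t x1 x2 x3 * pd3 v1 t x1 x2 x3 + pd1 P t x1 x2 x3 =
    ν * lap v1 t x1 x2 x3 +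
      (curl2 H1 H2 H3 t x1 x2 x3 * H3 t x1 x2 x3 - curl3 H1 H2 H3 t x1 x2 x3 * H2 t x1 x2 x3)) ∧
  (pdt v2 t x1 x2 x3 + v1 t x1 x2 x3 * pd1 v2 t x1 x2 x3 + v2 t x1 x2 x3 * pd2 v2 t x1 x2 x3 +
      v3 t x1 x2 x3 * pd3 v2 t x1 x2 x3 + pd2 P t x1 x2 x3 =
    ν * lap v2 t x1 x2 x3 +
      (curl3 H1 H2 H3 t x1 x2 x3 * H1 t x1 x2 x3 - curl1 H1 H2 H3 t x1 x2 x3 * H3 t x1 x2 x3)) ∧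
  (pdt v3 t x1 x2 x3 + v1 t x1 x2 x3 * pd1 v3 t x1 x2 x3 + v2 t x1 x2 x3 * pd2 v3 t x1 x2 x3 +
      v3 t x1 x2 x3 * pd3 v3 t x1 x2 x3 + pd3 P t x1 x2 x3 =
    ν * lap v3 t x1 x2 x3 +
      (curl1 H1 H2 H3 t x1 x2 x3 * H2 t x1 x2 x3 - curl2 H1 H2 H3 t x1 x2 x3 * H1 t x1 x2 x3))

/-- The induction equation `∂ₜH = ν ΔH + ∇×(v×H)` of the 3D incompressible MHD system
with viscosity `ν`, at the point `(t, x1, x2, x3)` (all three components). -/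
def indEq (ν : ℝ) (v1 v2 v3 H1 H2 H3 : F) (t x1 x2 x3 : ℝ) : Prop :=
  (pdt H1 t x1 x2 x3 = ν * lap H1 t x1 x2 x3 +
      curl1 (cr1 v1 v2 v3 H1 H2 H3) (cr2 v1 v2 v3 H1 H2 H3) (cr3 v1 v2 v3 H1 H2 H3) t x1 x2 x3) ∧
  (pdt H2 t x1 x2 x3 = ν * lap H2 t x1 x2 x3 +
      curl2 (cr1 v1 v2 v3 H1 H2 H3) (cr2 v1 v2 v3 H1 H2 H3) (cr3 v1 v2 v3 H1 H2 H3) t x1 x2 x3) ∧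
  (pdt H3 t x1 x2 x3 = ν * lap H3 t x1 x2 x3 +
      curl3 (cr1 v1 v2 v3 H1 H2 H3) (cr2 v1 v2 v3 H1 H2 H3) (cr3 v1 v2 v3 H1 H2 H3) t x1 x2 x3)

/-- The momentum equation `∂ₜv + (v·∇)v + ∇P = ν Δv` of the 3D incompressible
Navier–Stokes equations with viscosity `ν`, at a point (all three components). -/
def nsMomEq (ν : ℝ) (v1 v2 v3 P : F) (t x1 x2 x3 : ℝ) : Prop :=
  (pdt v1 t x1 x2 x3 + v1 t x1 x2 x3 * pd1 v1 t x1 x2 x3 + v2 t x1 x2 x3 * pd2 v1 t x1 x2 x3 +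
      v3 t x1 x2 x3 * pd3 v1 t x1 x2 x3 + pd1 P t x1 x2 x3 = ν * lap v1 t x1 x2 x3) ∧
  (pdt v2 t x1 x2 x3 + v1 t x1 x2 x3 * pd1 v2 t x1 x2 x3 + v2 t x1 x2 x3 * pd2 v2 t x1 x2 x3 +
      v3 t x1 x2 x3 * pd3 v2 t x1 x2 x3 + pd2 P t x1 x2 x3 = ν * lap v2 t x1 x2 x3) ∧
  (pdt v3 t x1 x2 x3 + v1 t x1 x2 x3 * pd1 v3 t x1 x2 x3 + v2 t x1 x2 x3 * pd2 v3 t x1 x2 x3 +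
      v3 t x1 x2 x3 * pd3 v3 t x1 x2 x3 + pd3 P t x1 x2 x3 = ν * lap v3 t x1 x2 x3)

/-- The full 3D incompressible MHD system with viscosity `ν` on all of `ℝ × ℝ³`:
momentum equation, induction equation, and the divergence-free conditions. -/
def MHDSystem (ν : ℝ) (v1 v2 v3 H1 H2 H3 P : F) : Prop :=
  ∀ t x1 x2 x3 : ℝ,
    momEq ν v1 v2 v3 H1 H2 H3 P t x1 x2 x3 ∧ indEq ν v1 v2 v3 H1 H2 H3 t x1 x2 x3 ∧
      divg v1 v2 v3 t x1 x2 x3 = 0 ∧ divg H1 H2 H3 t x1 x2 x3 = 0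

/-- Smoothness of a scalar field on `ℝ × ℝ³` (curried form). -/
def Smooth4 (f : F) : Prop :=
  ContDiff ℝ (⊤ : ℕ∞) (fun p : ℝ × ℝ × ℝ × ℝ => f p.1 p.2.1 p.2.2.1 p.2.2.2)

/-- First explicit family: first velocity component. -/
def V1 (T a k : ℝ) : F := fun t x1 x2 x3 => a * x1 / (T - t) + k * x2 / (x1 ^ 2 + x2 ^ 2)

/-- First explicit family: second velocity component. -/
def V2 (T a k : ℝ) : F := fun t x1 x2 x3 => a * x2 / (T - t) - k * x1 / (x1 ^ 2 + x2 ^ 2)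

/-- First explicit family: third velocity component. -/
def V3 (T a : ℝ) : F := fun t x1 x2 x3 => -(2 * a * x3) / (T - t)

/-- First explicit family: first magnetic field component. -/
def B1 (T a k ab : ℝ) : F := fun t x1 x2 x3 =>
  ab * x1 + 2 * ab * k * x2 * (T - t) / ((2 * a + 1) * (x1 ^ 2 + x2 ^ 2))

/-- First explicit family: second magnetic field component. -/
def B2 (T a k ab : ℝ) : F := fun t x1 x2 x3 =>
  ab * x2 - 2 * ab * k * x1 * (T - t) / ((2 * a + 1) * (x1 ^ 2 + x2 ^ 2))

/-- First explicit family: third magnetic field component. -/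
def B3 (ab : ℝ) : F := fun t x1 x2 x3 => -(2 * ab * x3)

/-- First explicit family: the pressure. -/
def Pr1 (T a k : ℝ) : F := fun t x1 x2 x3 =>
  -(1 / 2) * (a * (a + 1) * (x1 ^ 2 + x2 ^ 2) / (T - t) ^ 2 + k ^ 2 / (x1 ^ 2 + x2 ^ 2)) +
    a * (1 - 2 * a) * x3 ^ 2 / (T - t) ^ 2

/-- First component of a planar flow `A (x, y) + K (y, -x) / (x² + y²)`; the second component is
`strainVortex A (-K) y x`. -/
def strainVortex (A K x y : ℝ) : ℝ := A * x + K * y / (x ^ 2 + y ^ 2)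

section strainVortex

variable (A K : ℝ) {x y : ℝ}

theorem hasDerivAt_strainVortex_fst (h : x ^ 2 + y ^ 2 ≠ 0) :
    HasDerivAt (fun z => strainVortex A K z y) (A - 2 * K * x * y / (x ^ 2 + y ^ 2) ^ 2) x := by
  refine (((hasDerivAt_id' x).const_mul A).fun_add
    ((hasDerivAt_const x (K * y)).fun_div (((hasDerivAt_id' x).fun_pow 2).add_const (y ^ 2)) h)).congr_deriv
    ?_
  simp
  field_simp
  ring

theorem hasDerivAt_strainVortex_snd (h : x ^ 2 + y ^ 2 ≠ 0) :
    HasDerivAt (fun z => strainVortex A K x z)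
      (K * (x ^ 2 - y ^ 2) / (x ^ 2 + y ^ 2) ^ 2) y := by
  refine ((((hasDerivAt_id' y).const_mul K).fun_div
    (((hasDerivAt_id' y).fun_pow 2).const_add (x ^ 2)) h).const_add (A * x)).congr_deriv ?_
  simp
  field_simp
  ring

theorem deriv_deriv_strainVortex_fst (h : x ^ 2 + y ^ 2 ≠ 0) :
    deriv (fun z => deriv (fun w => strainVortex A K w y) z) x =
      K * (6 * x ^ 2 * y - 2 * y ^ 3) / (x ^ 2 + y ^ 2) ^ 3 := by
  have hne : ∀ᶠ z in nhds x, z ^ 2 + y ^ 2 ≠ 0 :=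
    (by fun_prop : ContinuousAt (fun z : ℝ => z ^ 2 + y ^ 2) x).eventually_ne h
  have heq : (fun z => deriv (fun w => strainVortex A K w y) z) =ᶠ[nhds x]
      fun z => A - 2 * K * z * y / (z ^ 2 + y ^ 2) ^ 2 :=
    hne.mono fun z hz => (hasDerivAt_strainVortex_fst A K hz).deriv
  rw [heq.deriv_eq]
  refine HasDerivAt.deriv ?_
  refine (((((hasDerivAt_id' x).const_mul (2 * K)).mul_const y).fun_div
    ((((hasDerivAt_id' x).fun_pow 2).add_const (y ^ 2)).fun_pow 2) (pow_ne_zero 2 h)).const_sub A).congr_deriv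
    ?_
  simp
  field_simp
  ring

theorem deriv_deriv_strainVortex_snd (h : x ^ 2 + y ^ 2 ≠ 0) :
    deriv (fun z => deriv (fun w => strainVortex A K x w) z) y =
      -(K * (6 * x ^ 2 * y - 2 * y ^ 3) / (x ^ 2 + y ^ 2) ^ 3) := by
  have hne : ∀ᶠ z in nhds y, x ^ 2 + z ^ 2 ≠ 0 :=
    (by fun_prop : ContinuousAt (fun z : ℝ => x ^ 2 + z ^ 2) y).eventually_ne h
  have heq : (fun z => deriv (fun w => strainVortex A K x w) z) =ᶠ[nhds y]
      fun z => K * (x ^ 2 - z ^ 2) / (x ^ 2 + z ^ 2) ^ 2 :=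
    hne.mono fun z hz => (hasDerivAt_strainVortex_snd A K hz).deriv
  rw [heq.deriv_eq]
  refine HasDerivAt.deriv ?_
  refine (((((hasDerivAt_id' y).fun_pow 2).const_sub (x ^ 2)).const_mul K).fun_div
    ((((hasDerivAt_id' y).fun_pow 2).const_add (x ^ 2)).fun_pow 2) (pow_ne_zero 2 h)).congr_deriv ?_
  simp
  field_simp
  ring

end strainVortex

theorem V1_eq (T a k : ℝ) :
    V1 T a k = fun t x1 x2 _ => strainVortex (a / (T - t)) k x1 x2 := by
  funext t x1 x2 x3
  simp only [V1, strainVortex]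
  ring

theorem V2_eq (T a k : ℝ) :
    V2 T a k = fun t x1 x2 _ => strainVortex (a / (T - t)) (-k) x2 x1 := by
  funext t x1 x2 x3
  simp only [V2, strainVortex, add_comm (x2 ^ 2)]
  ring

theorem B1_eq (T a k ab : ℝ) :
    B1 T a k ab = fun t x1 x2 _ =>
      strainVortex ab (2 * ab * k * (T - t) / (2 * a + 1)) x1 x2 := by
  funext t x1 x2 x3
  simp only [B1, strainVortex, div_eq_mul_inv, mul_inv]
  ring

theorem B2_eq (T a k ab : ℝ) :
    B2 T a k ab = fun t x1 x2 _ =>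
      strainVortex ab (-(2 * ab * k * (T - t) / (2 * a + 1))) x2 x1 := by
  funext t x1 x2 x3
  simp only [B2, strainVortex, div_eq_mul_inv, mul_inv, add_comm (x2 ^ 2)]
  ring

theorem hasDerivAt_const_div_sub {T t : ℝ} (c : ℝ) (h : T - t ≠ 0) :
    HasDerivAt (fun s => c / (T - s)) (c / (T - t) ^ 2) t := by
  refine ((hasDerivAt_const t c).fun_div ((hasDerivAt_id' t).const_sub T) h).congr_deriv ?_
  simp

section derivatives

variable {T t x1 x2 : ℝ} (a k ab x3 : ℝ)

theorem pdt_V1 (h : T - t ≠ 0) : pdt (V1 T a k) t x1 x2 x3 = a * x1 / (T - t) ^ 2 :=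
  ((hasDerivAt_const_div_sub (a * x1) h).add_const _).deriv

theorem pdt_V2 (h : T - t ≠ 0) : pdt (V2 T a k) t x1 x2 x3 = a * x2 / (T - t) ^ 2 :=
  ((hasDerivAt_const_div_sub (a * x2) h).sub_const _).deriv

theorem pdt_V3 (h : T - t ≠ 0) : pdt (V3 T a) t x1 x2 x3 = -(2 * a * x3) / (T - t) ^ 2 :=
  (hasDerivAt_const_div_sub (-(2 * a * x3)) h).deriv

theorem pd3_V3 : pd3 (V3 T a) t x1 x2 x3 = -(2 * a) / (T - t) := by
  refine HasDerivAt.deriv ?_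
  refine ((((hasDerivAt_id' x3).const_mul (2 * a)).neg).div_const (T - t)).congr_deriv ?_
  simp

theorem lap_V1 (h : x1 ^ 2 + x2 ^ 2 ≠ 0) : lap (V1 T a k) t x1 x2 x3 = 0 := by
  simp only [V1_eq, lap, pd1, pd2, pd3, deriv_deriv_strainVortex_fst _ _ h,
    deriv_deriv_strainVortex_snd _ _ h, deriv_const]
  ring

theorem lap_V2 (h : x1 ^ 2 + x2 ^ 2 ≠ 0) : lap (V2 T a k) t x1 x2 x3 = 0 := by
  rw [add_comm] at h
  simp only [V2_eq, lap, pd1, pd2, pd3, deriv_deriv_strainVortex_fst _ _ h,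
    deriv_deriv_strainVortex_snd _ _ h, deriv_const]
  ring

theorem lap_V3 : lap (V3 T a) t x1 x2 x3 = 0 := by
  have h3 : pd3 (V3 T a) = fun t _ _ _ => -(2 * a) / (T - t) := by
    funext t x1 x2 x3
    exact pd3_V3 a x3
  simp only [lap, h3]
  simp [pd1, pd2, pd3, V3]

theorem curl1_B : curl1 (B1 T a k ab) (B2 T a k ab) (B3 ab) t x1 x2 x3 = 0 := by
  simp [curl1, pd2, pd3, B2, B3]

theorem curl2_B : curl2 (B1 T a k ab) (B2 T a k ab) (B3 ab) t x1 x2 x3 = 0 := by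
  simp [curl2, pd1, pd3, B1, B3]

theorem curl3_B (h : x1 ^ 2 + x2 ^ 2 ≠ 0) :
    curl3 (B1 T a k ab) (B2 T a k ab) (B3 ab) t x1 x2 x3 = 0 := by
  have h' : x2 ^ 2 + x1 ^ 2 ≠ 0 := by rwa [add_comm]
  simp only [B1_eq, B2_eq, curl3, pd1, pd2, (hasDerivAt_strainVortex_snd _ _ h).deriv,
    (hasDerivAt_strainVortex_snd _ _ h').deriv, add_comm (x2 ^ 2)]
  ring

theorem pd1_Pr1 (h : x1 ^ 2 + x2 ^ 2 ≠ 0) :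
    pd1 (Pr1 T a k) t x1 x2 x3 =
      -(a * (a + 1) * x1 / (T - t) ^ 2) + k ^ 2 * x1 / (x1 ^ 2 + x2 ^ 2) ^ 2 := by
  have hr := ((hasDerivAt_id' x1).fun_pow 2).add_const (x2 ^ 2)
  refine HasDerivAt.deriv ?_
  refine (((((hr.const_mul (a * (a + 1))).div_const ((T - t) ^ 2)).fun_add
    ((hasDerivAt_const x1 (k ^ 2)).fun_div hr h)).const_mul (-(1 / 2))).add_const
    (a * (1 - 2 * a) * x3 ^ 2 / (T - t) ^ 2)).congr_deriv ?_
  simp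
  ring

theorem pd2_Pr1 (h : x1 ^ 2 + x2 ^ 2 ≠ 0) :
    pd2 (Pr1 T a k) t x1 x2 x3 =
      -(a * (a + 1) * x2 / (T - t) ^ 2) + k ^ 2 * x2 / (x1 ^ 2 + x2 ^ 2) ^ 2 := by
  have hr := ((hasDerivAt_id' x2).fun_pow 2).const_add (x1 ^ 2)
  refine HasDerivAt.deriv ?_
  refine (((((hr.const_mul (a * (a + 1))).div_const ((T - t) ^ 2)).fun_add
    ((hasDerivAt_const x2 (k ^ 2)).fun_div hr h)).const_mul (-(1 / 2))).add_const
    (a * (1 - 2 * a) * x3 ^ 2 / (T - t) ^ 2)).congr_deriv ?_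
  simp
  ring

theorem pd3_Pr1 :
    pd3 (Pr1 T a k) t x1 x2 x3 = 2 * a * (1 - 2 * a) * x3 / (T - t) ^ 2 := by
  refine HasDerivAt.deriv ?_
  refine (((((hasDerivAt_id' x3).fun_pow 2).const_mul (a * (1 - 2 * a))).div_const
    ((T - t) ^ 2)).const_add
    (-(1 / 2) * (a * (a + 1) * (x1 ^ 2 + x2 ^ 2) / (T - t) ^ 2 + k ^ 2 / (x1 ^ 2 + x2 ^ 2)))).congr_deriv
    ?_
  simp
  ring

end derivatives

/-- The first explicit family satisfies the momentum equation
`∂ₜv + (v·∇)v + ∇P = ν Δv + (∇×H)×H` at every point with `0 ≤ t < T*` and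
`x₁² + x₂² ≠ 0`. -/
theorem first_family_momentum (T ν a k ab : ℝ) (hT : 0 < T) (hν : 0 ≤ ν) (hk : k ≠ 0)
    (hab : ab ≠ 0) (ha : a ≠ -(1 / 2)) (ha0 : a ≠ 0) (t x1 x2 x3 : ℝ) (ht0 : 0 ≤ t)
    (htT : t < T) (hx : x1 ^ 2 + x2 ^ 2 ≠ 0) :
    momEq ν (V1 T a k) (V2 T a k) (V3 T a) (B1 T a k ab) (B2 T a k ab) (B3 ab)
      (Pr1 T a k) t x1 x2 x3 := by
  have hτ : T - t ≠ 0 := (sub_pos.2 htT).ne'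
  have hx' : x2 ^ 2 + x1 ^ 2 ≠ 0 := by rwa [add_comm]
  simp only [momEq, pdt_V1 _ _ _ hτ, pdt_V2 _ _ _ hτ, pdt_V3 _ _ hτ, lap_V1 _ _ _ hx,
    lap_V2 _ _ _ hx, lap_V3, curl1_B, curl2_B, curl3_B _ _ _ _ hx, pd1_Pr1 _ _ _ hx,
    pd2_Pr1 _ _ _ hx, pd3_Pr1, pd3_V3]
  simp only [V1_eq, V2_eq, pd1, pd2, pd3, (hasDerivAt_strainVortex_fst _ _ hx).deriv,
    (hasDerivAt_strainVortex_snd _ _ hx).deriv, (hasDerivAt_strainVortex_fst _ _ hx').deriv,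
    (hasDerivAt_strainVortex_snd _ _ hx').deriv, deriv_const, V3]
  simp only [strainVortex, add_comm (x2 ^ 2)]
  refine ⟨?_, ?_, ?_⟩ <;> field_simp <;> ring
end
end

section
/- Induction equation for the first explicit family: let T* > 0, ν ≥ 0, k ≠ 0, ā ≠ 0, and a ∈ ℝ with a ∉ {−1/2, 0}. Define, for 0 ≤ t < T* and x ∈ ℝ³ with x₁² + x₂² ≠ 0: v(t,x) = (a x₁/(T*−t) + k x₂/(x₁²+x₂²), a x₂/(T*−t) − k x₁/(x₁²+x₂²), −2a x₃/(T*−t)) and H(t,x) = (ā x₁ + 2āk x₂(T*−t)/((2a+1)(x₁²+x₂²)), ā x₂ − 2āk x₁(T*−t)/((2a+1)(x₁²+x₂²)), −2ā x₃). Then at every such point ∂ₜH = νΔH + ∇×(v×H). -/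
set_option linter.unusedVariables false

open Real Filter

noncomputable section

/-- First derivative of an affine function plus a fraction with quadratic denominator. -/
theorem deriv_affine_add_div (A B C D q y : ℝ) (hy : y ^ 2 + q ≠ 0) :
    deriv (fun z => A * z + B + (C * z + D) / (z ^ 2 + q)) y =
      A + C / (y ^ 2 + q) - 2 * y * (C * y + D) / (y ^ 2 + q) ^ 2 := by
  have h := ((((hasDerivAt_id y).const_mul A).add_const B).add
    ((((hasDerivAt_id y).const_mul C).add_const D).div
      (((hasDerivAt_id y).pow 2).add_const q) hy)).deriv
  refine Eq.trans h ?_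
  simp only [id, Pi.pow_apply]
  field_simp
  push_cast
  ring

/-- Second derivative of an affine function plus a fraction with quadratic denominator. -/
theorem deriv_deriv_affine_add_div (A B C D q y : ℝ) (hy : y ^ 2 + q ≠ 0) :
    deriv (fun w => deriv (fun z => A * z + B + (C * z + D) / (z ^ 2 + q)) w) y =
      -(6 * C * y + 2 * D) / (y ^ 2 + q) ^ 2 + 8 * y ^ 2 * (C * y + D) / (y ^ 2 + q) ^ 3 := by
  have hev : ∀ᶠ w in nhds y, w ^ 2 + q ≠ 0 :=
    ContinuousAt.eventually_ne (by fun_prop) hy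
  have hEq : (fun w => deriv (fun z => A * z + B + (C * z + D) / (z ^ 2 + q)) w) =ᶠ[nhds y]
      fun w => A + C / (w ^ 2 + q) - 2 * w * (C * w + D) / (w ^ 2 + q) ^ 2 :=
    hev.mono fun w hw => deriv_affine_add_div A B C D q w hw
  rw [hEq.deriv_eq]
  have hs := ((hasDerivAt_id y).pow 2).add_const q
  have h := ((((hasDerivAt_const y C).div hs hy).const_add A).sub
    ((((hasDerivAt_id y).const_mul 2).mul (((hasDerivAt_id y).const_mul C).add_const D)).div
      (hs.pow 2) (pow_ne_zero 2 hy))).deriv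
  refine Eq.trans h ?_
  simp only [id, Pi.pow_apply, Pi.mul_apply]
  field_simp
  push_cast
  ring

theorem lap_B1 (T a k ab t x1 x2 x3 : ℝ) (hx : x1 ^ 2 + x2 ^ 2 ≠ 0) :
    lap (B1 T a k ab) t x1 x2 x3 = 0 := by
  set c := 2 * ab * k * (T - t) / (2 * a + 1) with hc
  have h1 : ∀ y, B1 T a k ab t y x2 x3 = ab * y + 0 + (0 * y + c * x2) / (y ^ 2 + x2 ^ 2) := by
    intro y
    simp only [B1, hc, div_eq_mul_inv, mul_inv]
    ring
  have h2 : ∀ y, B1 T a k ab t x1 y x3 = 0 * y + ab * x1 + (c * y + 0) / (y ^ 2 + x1 ^ 2) := by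
    intro y
    simp only [B1, hc, div_eq_mul_inv, mul_inv, add_comm (x1 ^ 2)]
    ring
  have h3 : pd3 (pd3 (B1 T a k ab)) t x1 x2 x3 = 0 := by simp [pd3, B1]
  have hx' : x2 ^ 2 + x1 ^ 2 ≠ 0 := by rwa [add_comm]
  rw [lap, h3]
  simp only [pd1, pd2, h1, h2]
  rw [deriv_deriv_affine_add_div _ _ _ _ _ _ hx, deriv_deriv_affine_add_div _ _ _ _ _ _ hx',
    add_comm (x2 ^ 2)]
  field_simp
  ring

theorem lap_B2 (T a k ab t x1 x2 x3 : ℝ) (hx : x1 ^ 2 + x2 ^ 2 ≠ 0) :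
    lap (B2 T a k ab) t x1 x2 x3 = 0 := by
  set c := 2 * ab * k * (T - t) / (2 * a + 1) with hc
  have h1 : ∀ y, B2 T a k ab t y x2 x3 =
      0 * y + ab * x2 + (-c * y + 0) / (y ^ 2 + x2 ^ 2) := by
    intro y
    simp only [B2, hc, div_eq_mul_inv, mul_inv]
    ring
  have h2 : ∀ y, B2 T a k ab t x1 y x3 =
      ab * y + 0 + (0 * y + -c * x1) / (y ^ 2 + x1 ^ 2) := by
    intro y
    simp only [B2, hc, div_eq_mul_inv, mul_inv, add_comm (x1 ^ 2)]
    ring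
  have h3 : pd3 (pd3 (B2 T a k ab)) t x1 x2 x3 = 0 := by simp [pd3, B2]
  have hx' : x2 ^ 2 + x1 ^ 2 ≠ 0 := by rwa [add_comm]
  rw [lap, h3]
  simp only [pd1, pd2, h1, h2]
  rw [deriv_deriv_affine_add_div _ _ _ _ _ _ hx, deriv_deriv_affine_add_div _ _ _ _ _ _ hx',
    add_comm (x2 ^ 2)]
  field_simp
  ring

theorem lap_B3 (ab t x1 x2 x3 : ℝ) : lap (B3 ab) t x1 x2 x3 = 0 := by
  simp [lap, pd1, pd2, pd3, B3]

theorem cr1_V_B (T a k ab t x1 x2 x3 : ℝ) (ha : 2 * a + 1 ≠ 0) (ht : T - t ≠ 0) :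
    cr1 (V1 T a k) (V2 T a k) (V3 T a) (B1 T a k ab) (B2 T a k ab) (B3 ab) t x1 x2 x3 =
      2 * ab * k / (2 * a + 1) * (x1 / (x1 ^ 2 + x2 ^ 2)) * x3 := by
  obtain ⟨d, rfl⟩ : ∃ d, a = (d - 1) / 2 := ⟨2 * a + 1, by ring⟩
  have hd : 2 * ((d - 1) / 2) + 1 = d := by ring
  rw [hd] at ha
  simp only [hd, cr1, V2, V3, B2, B3]
  simp only [div_eq_mul_inv, mul_inv]
  generalize (x1 ^ 2 + x2 ^ 2)⁻¹ = r
  field_simp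
  ring

theorem cr2_V_B (T a k ab t x1 x2 x3 : ℝ) (ha : 2 * a + 1 ≠ 0) (ht : T - t ≠ 0) :
    cr2 (V1 T a k) (V2 T a k) (V3 T a) (B1 T a k ab) (B2 T a k ab) (B3 ab) t x1 x2 x3 =
      2 * ab * k / (2 * a + 1) * (x2 / (x1 ^ 2 + x2 ^ 2)) * x3 := by
  obtain ⟨d, rfl⟩ : ∃ d, a = (d - 1) / 2 := ⟨2 * a + 1, by ring⟩
  have hd : 2 * ((d - 1) / 2) + 1 = d := by ring
  rw [hd] at ha
  simp only [hd, cr2, V1, V3, B1, B3]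
  simp only [div_eq_mul_inv, mul_inv]
  generalize (x1 ^ 2 + x2 ^ 2)⁻¹ = r
  field_simp
  ring

theorem cr3_V_B (T a k ab t x1 x2 x3 : ℝ) (ha : 2 * a + 1 ≠ 0) (ht : T - t ≠ 0)
    (hx : x1 ^ 2 + x2 ^ 2 ≠ 0) :
    cr3 (V1 T a k) (V2 T a k) (V3 T a) (B1 T a k ab) (B2 T a k ab) (B3 ab) t x1 x2 x3 =
      ab * k / (2 * a + 1) := by
  obtain ⟨d, rfl⟩ : ∃ d, a = (d - 1) / 2 := ⟨2 * a + 1, by ring⟩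
  have hd : 2 * ((d - 1) / 2) + 1 = d := by ring
  rw [hd] at ha
  simp only [hd, cr3, V1, V2, B1, B2]
  field_simp
  ring

theorem deriv_mul_const_div (A B q y : ℝ) (hy : y ^ 2 + q ≠ 0) :
    deriv (fun z => A * (B / (z ^ 2 + q))) y = -(2 * y * A * B) / (y ^ 2 + q) ^ 2 := by
  have h := deriv_affine_add_div 0 0 0 (A * B) q y hy
  simp only [zero_mul, zero_add, zero_div, zero_sub] at h
  simp only [← mul_div_assoc, h]
  ring

/-- The first explicit family satisfies the induction equation
`∂ₜH = ν ΔH + ∇×(v×H)` at every point with `0 ≤ t < T*` and `x₁² + x₂² ≠ 0`. -/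
theorem first_family_induction (T ν a k ab : ℝ) (hT : 0 < T) (hν : 0 ≤ ν) (hk : k ≠ 0)
    (hab : ab ≠ 0) (ha : a ≠ -(1 / 2)) (ha0 : a ≠ 0) (t x1 x2 x3 : ℝ) (ht0 : 0 ≤ t)
    (htT : t < T) (hx : x1 ^ 2 + x2 ^ 2 ≠ 0) :
    indEq ν (V1 T a k) (V2 T a k) (V3 T a) (B1 T a k ab) (B2 T a k ab) (B3 ab)
      t x1 x2 x3 := by
  have ha' : 2 * a + 1 ≠ 0 := fun h => ha (by linarith)
  have ht : T - t ≠ 0 := (sub_pos.2 htT).ne'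
  have hx' : x2 ^ 2 + x1 ^ 2 ≠ 0 := by rwa [add_comm]
  set c := 2 * ab * k / (2 * a + 1) with hc
  have hlin : ∀ p : ℝ, deriv (fun y => p * y) x3 = p := fun p => by simp
  have hcr3₁ : (fun y => cr3 (V1 T a k) (V2 T a k) (V3 T a) (B1 T a k ab) (B2 T a k ab) (B3 ab)
      t y x2 x3) =ᶠ[nhds x1] fun _ => ab * k / (2 * a + 1) :=
    (ContinuousAt.eventually_ne (g := fun y : ℝ => y ^ 2 + x2 ^ 2) (by fun_prop) hx).mono
      fun y hy => cr3_V_B T a k ab t y x2 x3 ha' ht hy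
  have hcr3₂ : (fun y => cr3 (V1 T a k) (V2 T a k) (V3 T a) (B1 T a k ab) (B2 T a k ab) (B3 ab)
      t x1 y x3) =ᶠ[nhds x2] fun _ => ab * k / (2 * a + 1) :=
    (ContinuousAt.eventually_ne (g := fun y : ℝ => x1 ^ 2 + y ^ 2) (by fun_prop) hx).mono
      fun y hy => cr3_V_B T a k ab t x1 y x3 ha' ht hy
  have hB1 : pdt (B1 T a k ab) t x1 x2 x3 = -(c * (x2 / (x1 ^ 2 + x2 ^ 2))) := by
    have h : ∀ s, B1 T a k ab s x1 x2 x3 =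
        ab * x1 + c * (x2 / (x1 ^ 2 + x2 ^ 2)) * (T - s) := fun s => by
      simp only [B1, hc, div_eq_mul_inv, mul_inv]
      ring
    simp only [pdt, h]
    exact ((((hasDerivAt_id t).const_sub T).const_mul _).const_add _).deriv.trans (by ring)
  have hB2 : pdt (B2 T a k ab) t x1 x2 x3 = c * (x1 / (x1 ^ 2 + x2 ^ 2)) := by
    have h : ∀ s, B2 T a k ab s x1 x2 x3 =
        ab * x2 + -(c * (x1 / (x1 ^ 2 + x2 ^ 2))) * (T - s) := fun s => by
      simp only [B2, hc, div_eq_mul_inv, mul_inv]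
      ring
    simp only [pdt, h]
    exact ((((hasDerivAt_id t).const_sub T).const_mul _).const_add _).deriv.trans (by ring)
  have hB3 : pdt (B3 ab) t x1 x2 x3 = 0 := by simp [pdt, B3]
  refine ⟨?_, ?_, ?_⟩
  · rw [hB1, lap_B1 _ _ _ _ _ _ _ _ hx, curl1, pd2, hcr3₂.deriv_eq, pd3]
    simp only [cr2_V_B T a k ab t _ _ _ ha' ht, ← hc, hlin, deriv_const]
    ring
  · rw [hB2, lap_B2 _ _ _ _ _ _ _ _ hx, curl2, pd1, hcr3₁.deriv_eq, pd3]
    simp only [cr1_V_B T a k ab t _ _ _ ha' ht, ← hc, hlin, deriv_const]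
    ring
  · rw [hB3, lap_B3, curl3, pd1, pd2]
    simp only [cr1_V_B T a k ab t _ _ _ ha' ht, cr2_V_B T a k ab t _ _ _ ha' ht, ← hc,
      add_comm (x1 ^ 2), deriv_mul_const_field', deriv_mul_const_div _ _ _ _ hx,
      deriv_mul_const_div _ _ _ _ hx']
    ring
end
end

section
/- Finite-time blowup of the magnetic field of the second explicit family for a < −1/2: let T* > 0, k ≠ 0, ā ≠ 0, and a ∈ ℝ with a < −1/2, and define H(t,x) = (ā x₁ + 2āk x₂ x₃ (T*−t)^{2a+1}/(4a+1), ā x₂ − 2āk x₁ x₃ (T*−t)^{2a+1}/(4a+1), −2ā x₃) for 0 ≤ t < T* and x ∈ ℝ³. Then for every fixed x₀ = (x₁, x₂, x₃) ∈ ℝ³ with x₃ ≠ 0 and x₁² + x₂² ≠ 0, the Euclidean norm ‖H(t, x₀)‖ tends to +∞ as t → T* from the left. -/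
set_option linter.unusedVariables false

open Real Filter

noncomputable section

/-- Second explicit family: first velocity component. -/
def W1 (T a k : ℝ) : F := fun t x1 x2 x3 => a * x1 / (T - t) + k * x2 * (T - t) ^ (2 * a)

/-- Second explicit family: second velocity component. -/
def W2 (T a k : ℝ) : F := fun t x1 x2 x3 => a * x2 / (T - t) - k * x1 * (T - t) ^ (2 * a)

/-- Second explicit family: third velocity component. -/
def W3 (T a : ℝ) : F := fun t x1 x2 x3 => -(2 * a * x3) / (T - t)

/-- Second explicit family: first magnetic field component. -/
def C1 (T a k ab : ℝ) : F := fun t x1 x2 x3 =>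
  ab * x1 + 2 * ab * k * x2 * x3 * (T - t) ^ (2 * a + 1) / (4 * a + 1)

/-- Second explicit family: second magnetic field component. -/
def C2 (T a k ab : ℝ) : F := fun t x1 x2 x3 =>
  ab * x2 - 2 * ab * k * x1 * x3 * (T - t) ^ (2 * a + 1) / (4 * a + 1)

/-- Second explicit family: third magnetic field component. -/
def C3 (ab : ℝ) : F := fun t x1 x2 x3 => -(2 * ab * x3)

/-- Second explicit family: the pressure (MHD case). -/
def Pr2 (T a k ab : ℝ) : F := fun t x1 x2 x3 =>
  (x1 ^ 2 + x2 ^ 2) / 2 *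
      (k ^ 2 * (T - t) ^ (4 * a) - a * (a + 1) / (T - t) ^ 2 -
        8 * ab ^ 2 * k ^ 2 * x3 ^ 2 * (T - t) ^ (4 * a + 2) / (4 * a + 1) ^ 2) +
    x3 ^ 2 *
      (a * (1 - 2 * a) / (T - t) ^ 2 -
        2 * ab ^ 2 * k ^ 2 * (x1 ^ 2 + x2 ^ 2) * (T - t) ^ (4 * a + 2) / (4 * a + 1) ^ 2)

/-- Finite-time blowup of the magnetic field of the second explicit family for
`a < −1/2`: at every fixed point `x₀` with `x₃ ≠ 0` and `x₁² + x₂² ≠ 0`, the Euclidean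
norm `‖H(t, x₀)‖` tends to `+∞` as `t → T*⁻` within `[0, T*)`. -/
theorem second_family_magnetic_blowup (T a k ab : ℝ) (hT : 0 < T) (hk : k ≠ 0)
    (hab : ab ≠ 0) (ha : a < -(1 / 2)) (x1 x2 x3 : ℝ) (hx3 : x3 ≠ 0)
    (hx : x1 ^ 2 + x2 ^ 2 ≠ 0) :
    Tendsto
      (fun t : ℝ => Real.sqrt ((C1 T a k ab t x1 x2 x3) ^ 2 + (C2 T a k ab t x1 x2 x3) ^ 2 +
        (C3 ab t x1 x2 x3) ^ 2))
      (nhdsWithin T (Set.Ico 0 T)) atTop := by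
  have h4 : 4 * a + 1 ≠ 0 := by linarith
  have hR : 0 < x1 ^ 2 + x2 ^ 2 := lt_of_le_of_ne (by positivity) hx.symm
  set c : ℝ := 2 * ab * k * x3 / (4 * a + 1) with hc
  have hc0 : c ≠ 0 := by positivity
  have hpos : 0 < √(x1 ^ 2 + x2 ^ 2) * |c| := by positivity
  have hsub : Tendsto (fun t : ℝ => T - t) (nhdsWithin T (Set.Ico 0 T))
      (nhdsWithin 0 (Set.Ioi 0)) := by
    refine tendsto_nhdsWithin_iff.2 ⟨?_, ?_⟩
    · have h : Tendsto (fun t : ℝ => T - t) (nhds T) (nhds (T - T)) :=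
        (continuous_const.sub continuous_id).tendsto T
      rw [sub_self] at h
      exact h.mono_left nhdsWithin_le_nhds
    · filter_upwards [self_mem_nhdsWithin] with t ht
      exact sub_pos.2 ht.2
  have hu : Tendsto (fun t : ℝ => (T - t) ^ (2 * a + 1)) (nhdsWithin T (Set.Ico 0 T)) atTop :=
    (tendsto_rpow_neg_nhdsGT_zero (by linarith)).comp hsub
  refine tendsto_atTop_mono (fun t => ?_) (hu.const_mul_atTop hpos)
  apply Real.le_sqrt_of_sq_le
  have hC1 : C1 T a k ab t x1 x2 x3 = ab * x1 + c * x2 * (T - t) ^ (2 * a + 1) := by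
    simp only [C1, hc]
    ring
  have hC2 : C2 T a k ab t x1 x2 x3 = ab * x2 - c * x1 * (T - t) ^ (2 * a + 1) := by
    simp only [C2, hc]
    ring
  rw [hC1, hC2, mul_pow, mul_pow, Real.sq_sqrt hR.le, sq_abs]
  nlinarith [mul_nonneg (sq_nonneg ab) hR.le, sq_nonneg (C3 ab t x1 x2 x3)]
end
end

section
/- Second explicit blowup family for the 3D incompressible Navier–Stokes equations (Proposition 2.1, second family, in Cartesian form): let T* > 0, ν ≥ 0, and a, k ∈ ℝ ∖ {0}. Define, for 0 ≤ t < T* and x ∈ ℝ³: v(t,x) = (a x₁/(T*−t) + k x₂(T*−t)^{2a}, a x₂/(T*−t) − k x₁(T*−t)^{2a}, −2a x₃/(T*−t)) and P(t,x) = ((x₁²+x₂²)/2)(k²(T*−t)^{4a} − a(a+1)/(T*−t)²) + a(1−2a) x₃²/(T*−t)². Then at every such point ∂ₜv + (v·∇)v + ∇P = νΔv and ∇·v = 0. -/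
set_option linter.unusedVariables false

open Real Filter

noncomputable section

/-- Pressure of the second explicit family in the Navier–Stokes case. -/
def Pr2NS (T a k : ℝ) : F := fun t x1 x2 x3 =>
  (x1 ^ 2 + x2 ^ 2) / 2 * (k ^ 2 * (T - t) ^ (4 * a) - a * (a + 1) / (T - t) ^ 2) +
    a * (1 - 2 * a) * x3 ^ 2 / (T - t) ^ 2

/-- The time derivative of `c / (T - t) + d * (T - t) ^ p` away from `t = T`. -/
theorem deriv_div_add_mul_rpow (T c d p t : ℝ) (h : t < T) :
    deriv (fun s => c / (T - s) + d * (T - s) ^ p) t =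
      c / (T - t) ^ 2 - p * d * (T - t) ^ p / (T - t) := by
  have hs : T - t ≠ 0 := (sub_pos.2 h).ne'
  have h0 : HasDerivAt (fun s : ℝ => T - s) (-1) t := (hasDerivAt_id t).const_sub T
  have h1 := ((hasDerivAt_const t c).div h0 hs).add
    ((h0.rpow_const (p := p) (Or.inl hs)).const_mul d)
  refine h1.deriv.trans ?_
  rw [Real.rpow_sub_one hs]
  field_simp
  ring

/-- The derivative of an affine function of one real variable. -/
theorem deriv_mul_add_const (m b x : ℝ) : deriv (fun y : ℝ => m * y + b) x = m := by
  simp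

/-- The derivative of an even quadratic function of one real variable. -/
theorem deriv_mul_sq_add_const (m b x : ℝ) :
    deriv (fun y : ℝ => m * y ^ 2 + b) x = 2 * m * x := by
  simp
  ring

theorem pd1_W1 (T a k : ℝ) :
    pd1 (W1 T a k) = fun t x1 x2 x3 => a / (T - t) := by
  funext t x1 x2 x3
  refine Eq.trans (congrArg (fun f : ℝ → ℝ => deriv f x1) (funext fun y => ?_))
    (deriv_mul_add_const (a / (T - t)) (k * x2 * (T - t) ^ (2 * a)) x1)
  simp only [W1]
  ring

theorem pd2_W1 (T a k : ℝ) :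
    pd2 (W1 T a k) = fun t x1 x2 x3 => k * (T - t) ^ (2 * a) := by
  funext t x1 x2 x3
  refine Eq.trans (congrArg (fun f : ℝ → ℝ => deriv f x2) (funext fun y => ?_))
    (deriv_mul_add_const (k * (T - t) ^ (2 * a)) (a * x1 / (T - t)) x2)
  simp only [W1]
  ring

theorem pd3_W1 (T a k : ℝ) :
    pd3 (W1 T a k) = fun t x1 x2 x3 => 0 := by
  funext t x1 x2 x3
  refine Eq.trans (congrArg (fun f : ℝ → ℝ => deriv f x3) (funext fun y => ?_))
    (deriv_mul_add_const 0 (W1 T a k t x1 x2 x3) x3)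
  simp only [W1]
  ring

theorem pd1_W2 (T a k : ℝ) :
    pd1 (W2 T a k) = fun t x1 x2 x3 => -(k * (T - t) ^ (2 * a)) := by
  funext t x1 x2 x3
  refine Eq.trans (congrArg (fun f : ℝ → ℝ => deriv f x1) (funext fun y => ?_))
    (deriv_mul_add_const (-(k * (T - t) ^ (2 * a))) (a * x2 / (T - t)) x1)
  simp only [W2]
  ring

theorem pd2_W2 (T a k : ℝ) :
    pd2 (W2 T a k) = fun t x1 x2 x3 => a / (T - t) := by
  funext t x1 x2 x3
  refine Eq.trans (congrArg (fun f : ℝ → ℝ => deriv f x2) (funext fun y => ?_))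
    (deriv_mul_add_const (a / (T - t)) (-(k * x1 * (T - t) ^ (2 * a))) x2)
  simp only [W2]
  ring

theorem pd3_W2 (T a k : ℝ) :
    pd3 (W2 T a k) = fun t x1 x2 x3 => 0 := by
  funext t x1 x2 x3
  refine Eq.trans (congrArg (fun f : ℝ → ℝ => deriv f x3) (funext fun y => ?_))
    (deriv_mul_add_const 0 (W2 T a k t x1 x2 x3) x3)
  simp only [W2]
  ring

theorem pd1_W3 (T a : ℝ) :
    pd1 (W3 T a) = fun t x1 x2 x3 => 0 := by
  funext t x1 x2 x3
  refine Eq.trans (congrArg (fun f : ℝ → ℝ => deriv f x1) (funext fun y => ?_))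
    (deriv_mul_add_const 0 (W3 T a t x1 x2 x3) x1)
  simp only [W3]
  ring

theorem pd2_W3 (T a : ℝ) :
    pd2 (W3 T a) = fun t x1 x2 x3 => 0 := by
  funext t x1 x2 x3
  refine Eq.trans (congrArg (fun f : ℝ → ℝ => deriv f x2) (funext fun y => ?_))
    (deriv_mul_add_const 0 (W3 T a t x1 x2 x3) x2)
  simp only [W3]
  ring

theorem pd3_W3 (T a : ℝ) :
    pd3 (W3 T a) = fun t x1 x2 x3 => -(2 * a) / (T - t) := by
  funext t x1 x2 x3
  refine Eq.trans (congrArg (fun f : ℝ → ℝ => deriv f x3) (funext fun y => ?_))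
    (deriv_mul_add_const (-(2 * a) / (T - t)) 0 x3)
  simp only [W3]
  ring

theorem pd1_Pr2NS (T a k : ℝ) :
    pd1 (Pr2NS T a k) = fun t x1 x2 x3 =>
      x1 * (k ^ 2 * (T - t) ^ (4 * a) - a * (a + 1) / (T - t) ^ 2) := by
  funext t x1 x2 x3
  refine Eq.trans (congrArg (fun f : ℝ → ℝ => deriv f x1) (funext fun y => ?_))
    ((deriv_mul_sq_add_const
      ((k ^ 2 * (T - t) ^ (4 * a) - a * (a + 1) / (T - t) ^ 2) / 2)
      (x2 ^ 2 / 2 * (k ^ 2 * (T - t) ^ (4 * a) - a * (a + 1) / (T - t) ^ 2) +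
        a * (1 - 2 * a) * x3 ^ 2 / (T - t) ^ 2) x1).trans (by ring))
  simp only [Pr2NS]
  ring

theorem pd2_Pr2NS (T a k : ℝ) :
    pd2 (Pr2NS T a k) = fun t x1 x2 x3 =>
      x2 * (k ^ 2 * (T - t) ^ (4 * a) - a * (a + 1) / (T - t) ^ 2) := by
  funext t x1 x2 x3
  refine Eq.trans (congrArg (fun f : ℝ → ℝ => deriv f x2) (funext fun y => ?_))
    ((deriv_mul_sq_add_const
      ((k ^ 2 * (T - t) ^ (4 * a) - a * (a + 1) / (T - t) ^ 2) / 2)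
      (x1 ^ 2 / 2 * (k ^ 2 * (T - t) ^ (4 * a) - a * (a + 1) / (T - t) ^ 2) +
        a * (1 - 2 * a) * x3 ^ 2 / (T - t) ^ 2) x2).trans (by ring))
  simp only [Pr2NS]
  ring

theorem pd3_Pr2NS (T a k : ℝ) :
    pd3 (Pr2NS T a k) = fun t x1 x2 x3 => 2 * (a * (1 - 2 * a)) * x3 / (T - t) ^ 2 := by
  funext t x1 x2 x3
  refine Eq.trans (congrArg (fun f : ℝ → ℝ => deriv f x3) (funext fun y => ?_))
    ((deriv_mul_sq_add_const
      (a * (1 - 2 * a) / (T - t) ^ 2)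
      ((x1 ^ 2 + x2 ^ 2) / 2 * (k ^ 2 * (T - t) ^ (4 * a) - a * (a + 1) / (T - t) ^ 2)) x3).trans (by ring))
  simp only [Pr2NS]
  ring

theorem pdt_W1 (T a k t x1 x2 x3 : ℝ) (h : t < T) :
    pdt (W1 T a k) t x1 x2 x3 =
      a * x1 / (T - t) ^ 2 - 2 * a * (k * x2) * (T - t) ^ (2 * a) / (T - t) := by
  refine Eq.trans (congrArg (fun f : ℝ → ℝ => deriv f t) (funext fun s => ?_))
    ((deriv_div_add_mul_rpow T (a * x1) (k * x2) (2 * a) t h).trans (by ring))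
  simp only [W1]

theorem pdt_W2 (T a k t x1 x2 x3 : ℝ) (h : t < T) :
    pdt (W2 T a k) t x1 x2 x3 =
      a * x2 / (T - t) ^ 2 + 2 * a * (k * x1) * (T - t) ^ (2 * a) / (T - t) := by
  refine Eq.trans (congrArg (fun f : ℝ → ℝ => deriv f t) (funext fun s => ?_))
    ((deriv_div_add_mul_rpow T (a * x2) (-(k * x1)) (2 * a) t h).trans (by ring))
  simp only [W2]
  ring

theorem pdt_W3 (T a t x1 x2 x3 : ℝ) (h : t < T) :
    pdt (W3 T a) t x1 x2 x3 = -(2 * a * x3) / (T - t) ^ 2 := by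
  refine Eq.trans (congrArg (fun f : ℝ → ℝ => deriv f t) (funext fun s => ?_))
    ((deriv_div_add_mul_rpow T (-(2 * a * x3)) 0 (2 * a) t h).trans (by ring))
  simp only [W3]
  ring

theorem lap_W1 (T a k t x1 x2 x3 : ℝ) : lap (W1 T a k) t x1 x2 x3 = 0 := by
  simp only [lap, pd1_W1, pd2_W1, pd3_W1]
  simp [pd1, pd2, pd3]

theorem lap_W2 (T a k t x1 x2 x3 : ℝ) : lap (W2 T a k) t x1 x2 x3 = 0 := by
  simp only [lap, pd1_W2, pd2_W2, pd3_W2]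
  simp [pd1, pd2, pd3]

theorem lap_W3 (T a t x1 x2 x3 : ℝ) : lap (W3 T a) t x1 x2 x3 = 0 := by
  simp only [lap, pd1_W3, pd2_W3, pd3_W3]
  simp [pd1, pd2, pd3]

/-- The second explicit family of blowup solutions for the 3D incompressible
Navier–Stokes equations: momentum equation `∂ₜv + (v·∇)v + ∇P = ν Δv` and
`∇·v = 0` at every point with `0 ≤ t < T*` and `x ∈ ℝ³`. -/
theorem second_family_navier_stokes (T ν a k : ℝ) (hT : 0 < T) (hν : 0 ≤ ν) (ha0 : a ≠ 0)
    (hk : k ≠ 0) (t x1 x2 x3 : ℝ) (ht0 : 0 ≤ t) (htT : t < T) :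
    nsMomEq ν (W1 T a k) (W2 T a k) (W3 T a) (Pr2NS T a k) t x1 x2 x3 ∧
    divg (W1 T a k) (W2 T a k) (W3 T a) t x1 x2 x3 = 0 := by
  have hs : T - t ≠ 0 := (sub_pos.2 htT).ne'
  have hg : (T - t) ^ (4 * a) = ((T - t) ^ (2 * a)) ^ 2 := by
    rw [← Real.rpow_mul_natCast (sub_pos.2 htT).le]
    congr 1
    push_cast
    ring
  refine ⟨⟨?_, ?_, ?_⟩, ?_⟩
  · rw [pdt_W1 T a k t x1 x2 x3 htT, lap_W1, pd1_W1, pd2_W1, pd3_W1, pd1_Pr2NS]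
    simp only [W1, W2, W3, hg]
    field_simp
    ring
  · rw [pdt_W2 T a k t x1 x2 x3 htT, lap_W2, pd1_W2, pd2_W2, pd3_W2, pd2_Pr2NS]
    simp only [W1, W2, W3, hg]
    field_simp
    ring
  · rw [pdt_W3 T a t x1 x2 x3 htT, lap_W3, pd1_W3, pd2_W3, pd3_W3, pd3_Pr2NS]
    simp only [W1, W2, W3]
    field_simp
    ring
  · simp only [divg, pd1_W1, pd2_W2, pd3_W3]
    ring
end
end

section
/- Proposition 2.2, first family: let T* > 0, ν ≥ 0, k ≠ 0, ā ≠ 0, and a ∈ ℝ with a ∉ {−1/2, 0}. Define, for 0 ≤ t < T*, r > 0, z ∈ ℝ: v^r = a r/(T*−t), v^θ = k/r, v^z = −2a z/(T*−t), H^r = ā r, H^θ = 2kā(T*−t)/((2a+1) r), H^z = −2ā z, and P̄ = P + (1/2)((H^r)² + (H^θ)² + (H^z)²) with P(t,r,z) = −(1/2)(a(a+1) r²/(T*−t)² + k²/r²) + a(1−2a) z²/(T*−t)². Then these functions satisfy, at every such point, the axisymmetric MHD system: (i) ∂ₜv^r + v^r ∂_r v^r + v^z ∂_z v^r − (v^θ)²/r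 + ∂_r P̄ = ν(Δ − 1/r²)v^r + H^r ∂_r H^r + H^z ∂_z H^r − (H^θ)²/r; (ii) ∂ₜv^θ + v^r ∂_r v^θ + v^z ∂_z v^θ + v^r v^θ/r = ν(Δ − 1/r²)v^θ + H^r ∂_r H^θ + H^z ∂_z H^θ + H^θ H^r/r; (iii) ∂ₜv^z + v^r ∂_r v^z + v^z ∂_z v^z + ∂_z P̄ = νΔv^z + H^r ∂_r H^z + H^z ∂_z H^z; (iv) ∂ₜH^r + v^r ∂_r H^r + v^z ∂_z H^r = ν(Δ − 1/r²)H^r + H^r ∂_r v^r + H^z ∂_z v^r; (v) ∂ₜH^θ + v^r ∂_r H^θ + v^z ∂_z H^θ + H^r v^θ/r = ν(Δ − 1/r²)H^θ + H^r ∂_r v^θ + H^z ∂_z v^θ + v^r H^θ/r; (vi) ∂ₜH^z + v^r ∂_r H^z + v^z ∂_z H^z = νΔH^z + H^r ∂_r v^z + H^z ∂_z v^z; together with the incompressibility conditions ∂_r(r v^r) + ∂_z(r v^z) = 0 and ∂_r(r H^r) + ∂_z(r H^z) = 0. -/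
set_option linter.unusedVariables false

open Real Filter

noncomputable section

/-- Scalar fields of time and cylindrical coordinates, in curried form `f t r z`. -/
abbrev G : Type := ℝ → ℝ → ℝ → ℝ

/-- Time partial derivative `∂ₜ`. -/
def cdt (f : G) : G := fun t r z => deriv (fun s => f s r z) t

/-- Radial partial derivative `∂_r`. -/
def cdr (f : G) : G := fun t r z => deriv (fun y => f t y z) r

/-- Axial partial derivative `∂_z`. -/
def cdz (f : G) : G := fun t r z => deriv (fun y => f t r y) z

/-- The axisymmetric Laplacian `Δf = ∂_r²f + (1/r)∂_r f + ∂_z²f`. -/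
def alap (f : G) : G := fun t r z =>
  cdr (cdr f) t r z + (1 / r) * cdr f t r z + cdz (cdz f) t r z

/-- The 3D incompressible MHD system in cylindrical coordinates for axisymmetric
fields `(v^r, v^θ, v^z, H^r, H^θ, H^z)` with modified pressure `P̄ = P + |H|²/2`,
at the point `(t, r, z)`: the six evolution equations together with the two
incompressibility conditions. -/
def AxiMHD (ν : ℝ) (vr vθ vz Hr Hθ Hz Pb : G) (t r z : ℝ) : Prop :=
  (cdt vr t r z + vr t r z * cdr vr t r z + vz t r z * cdz vr t r z - (vθ t r z) ^ 2 / r +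
      cdr Pb t r z =
    ν * (alap vr t r z - vr t r z / r ^ 2) + Hr t r z * cdr Hr t r z +
      Hz t r z * cdz Hr t r z - (Hθ t r z) ^ 2 / r) ∧
  (cdt vθ t r z + vr t r z * cdr vθ t r z + vz t r z * cdz vθ t r z +
      vr t r z * vθ t r z / r =
    ν * (alap vθ t r z - vθ t r z / r ^ 2) + Hr t r z * cdr Hθ t r z +
      Hz t r z * cdz Hθ t r z + Hθ t r z * Hr t r z / r) ∧
  (cdt vz t r z + vr t r z * cdr vz t r z + vz t r z * cdz vz t r z + cdz Pb t r z =
    ν * alap vz t r z + Hr t r z * cdr Hz t r z + Hz t r z * cdz Hz t r z) ∧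
  (cdt Hr t r z + vr t r z * cdr Hr t r z + vz t r z * cdz Hr t r z =
    ν * (alap Hr t r z - Hr t r z / r ^ 2) + Hr t r z * cdr vr t r z +
      Hz t r z * cdz vr t r z) ∧
  (cdt Hθ t r z + vr t r z * cdr Hθ t r z + vz t r z * cdz Hθ t r z +
      Hr t r z * vθ t r z / r =
    ν * (alap Hθ t r z - Hθ t r z / r ^ 2) + Hr t r z * cdr vθ t r z +
      Hz t r z * cdz vθ t r z + vr t r z * Hθ t r z / r) ∧
  (cdt Hz t r z + vr t r z * cdr Hz t r z + vz t r z * cdz Hz t r z =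
    ν * alap Hz t r z + Hr t r z * cdr vz t r z + Hz t r z * cdz vz t r z) ∧
  (cdr (fun t r z => r * vr t r z) t r z + cdz (fun t r z => r * vz t r z) t r z = 0) ∧
  (cdr (fun t r z => r * Hr t r z) t r z + cdz (fun t r z => r * Hz t r z) t r z = 0)

/-- The radial derivative of a field linear in `r`. -/
theorem cdr_mul_radius (g : ℝ → ℝ) :
    cdr (fun t r _ => g t * r) = fun t _ _ => g t := by
  funext t r z
  simp [cdr]

/-- The radial derivative of a field inversely proportional to `r`, valid also at `r = 0` with
the convention `1 / 0 = 0`. -/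
theorem cdr_div_radius (g : ℝ → ℝ) :
    cdr (fun t r _ => g t / r) = fun t r _ => -g t / r ^ 2 := by
  funext t r z
  simp only [cdr, div_eq_mul_inv, deriv_const_mul_field', deriv_inv]
  ring

/-- The axial derivative of a field linear in `z`. -/
theorem cdz_mul_height (g : ℝ → ℝ) :
    cdz (fun t _ z => g t * z) = fun t _ _ => g t := by
  funext t r z
  simp [cdz]

theorem cdz_of_height_independent (f : ℝ → ℝ → ℝ) : cdz (fun t r _ => f t r) = 0 := by
  funext t r z
  simp [cdz]

theorem cdr_of_radius_independent (f : ℝ → ℝ → ℝ) : cdr (fun t _ z => f t z) = 0 := by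
  funext t r z
  simp [cdr]

theorem alap_mul_radius (g : ℝ → ℝ) (t r z : ℝ) :
    alap (fun t r _ => g t * r) t r z = g t * r / r ^ 2 := by
  have h : cdz (0 : G) = 0 := cdz_of_height_independent 0
  simp only [alap, cdr_mul_radius, cdz_of_height_independent,
    cdr_of_radius_independent fun t _ => g t, h, Pi.zero_apply]
  rcases eq_or_ne r 0 with rfl | hr
  · simp
  · field_simp
    ring

theorem alap_div_radius (g : ℝ → ℝ) (t z : ℝ) {r : ℝ} (hr : r ≠ 0) :
    alap (fun t r _ => g t / r) t r z = g t / r / r ^ 2 := by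
  have h : cdz (0 : G) = 0 := cdz_of_height_independent 0
  have h2 : cdr (fun t r _ => -g t / r ^ 2) t r z = 2 * g t / r ^ 3 := by
    refine (((hasDerivAt_const r (-g t)).div (hasDerivAt_pow 2 r)
      (pow_ne_zero 2 hr)).congr_deriv ?_).deriv
    field_simp
    push_cast
    ring
  simp only [alap, cdr_div_radius, h2, cdz_of_height_independent, h, Pi.zero_apply]
  field_simp
  ring

theorem alap_mul_height (g : ℝ → ℝ) (t r z : ℝ) :
    alap (fun t _ z => g t * z) t r z = 0 := by
  have h : cdr (0 : G) = 0 := cdr_of_radius_independent 0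
  simp only [alap, cdr_of_radius_independent fun t z => g t * z, h, cdz_mul_height,
    cdz_of_height_independent fun t _ => g t, Pi.zero_apply]
  ring

/-- The time derivative of a field proportional to `1 / (T - t)`. -/
theorem hasDerivAt_div_sub (T c : ℝ) {t : ℝ} (h : T - t ≠ 0) :
    HasDerivAt (fun s => c / (T - s)) (c / (T - t) ^ 2) t := by
  refine ((hasDerivAt_const t c).div ((hasDerivAt_id t).const_sub T) h).congr_deriv ?_
  simp

/-- Proposition 2.2, first family: the fields `v^r = ar/(T*−t)`, `v^θ = k/r`,
`v^z = −2az/(T*−t)`, `H^r = ā r`, `H^θ = 2kā(T*−t)/((2a+1)r)`, `H^z = −2ā z`, with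
modified pressure `P̄ = P + |H|²/2`, solve the axisymmetric MHD system for
`0 ≤ t < T*`, `r > 0`, `z ∈ ℝ`. -/
theorem prop22_first_family (T ν a k ab : ℝ) (hT : 0 < T) (hν : 0 ≤ ν) (hk : k ≠ 0)
    (hab : ab ≠ 0) (ha : a ≠ -(1 / 2)) (ha0 : a ≠ 0) (t r z : ℝ) (ht0 : 0 ≤ t)
    (htT : t < T) (hr : 0 < r) :
    AxiMHD ν
      (fun t r _ => a * r / (T - t))
      (fun _ r _ => k / r)
      (fun t _ z => -(2 * a * z) / (T - t))
      (fun _ r _ => ab * r)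
      (fun t r _ => 2 * k * ab * (T - t) / ((2 * a + 1) * r))
      (fun _ _ z => -(2 * ab * z))
      (fun t r z =>
        (-(1 / 2) * (a * (a + 1) * r ^ 2 / (T - t) ^ 2 + k ^ 2 / r ^ 2) +
            a * (1 - 2 * a) * z ^ 2 / (T - t) ^ 2) +
          (1 / 2) * ((ab * r) ^ 2 + (2 * k * ab * (T - t) / ((2 * a + 1) * r)) ^ 2 +
            (-(2 * ab * z)) ^ 2))
      t r z := by
  have hτ : T - t ≠ 0 := (sub_pos.2 htT).ne'
  have hr' : r ≠ 0 := hr.ne'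
  have hc : 2 * a + 1 ≠ 0 := fun h => ha (by linarith)
  have evr : (fun t r _ => a * r / (T - t) : G) = fun t r _ => a / (T - t) * r := by
    funext t r z; ring
  have evz : (fun t _ z => -(2 * a * z) / (T - t) : G) =
      fun t _ z => -2 * a / (T - t) * z := by
    funext t r z; ring
  have eHθ : (fun t r _ => 2 * k * ab * (T - t) / ((2 * a + 1) * r) : G) =
      fun t r _ => 2 * k * ab / (2 * a + 1) * (T - t) / r := by
    funext t r z
    rw [← div_div, mul_div_right_comm]
  have eHz : (fun _ _ z => -(2 * ab * z) : G) = fun _ _ z => -2 * ab * z := by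
    funext t r z; ring
  have hPr : cdr (fun t r z =>
        (-(1 / 2) * (a * (a + 1) * r ^ 2 / (T - t) ^ 2 + k ^ 2 / r ^ 2) +
            a * (1 - 2 * a) * z ^ 2 / (T - t) ^ 2) +
          (1 / 2) * ((ab * r) ^ 2 + (2 * k * ab * (T - t) / ((2 * a + 1) * r)) ^ 2 +
            (-(2 * ab * z)) ^ 2)) t r z =
      -(a * (a + 1)) * r / (T - t) ^ 2 + k ^ 2 / r ^ 3 + ab ^ 2 * r -
        (2 * k * ab / (2 * a + 1) * (T - t)) ^ 2 / r ^ 3 := by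
    have h1 := ((hasDerivAt_pow 2 r).const_mul (a * (a + 1))).div_const ((T - t) ^ 2)
    have h2 := (hasDerivAt_const r (k ^ 2)).div (hasDerivAt_pow 2 r) (pow_ne_zero 2 hr')
    have h3 := ((hasDerivAt_id r).const_mul ab).pow 2
    have h4 := ((hasDerivAt_const r (2 * k * ab * (T - t))).div
      ((hasDerivAt_id r).const_mul (2 * a + 1)) (mul_ne_zero hc hr')).pow 2
    refine (((((h1.add h2).const_mul (-(1 / 2))).add_const
      (a * (1 - 2 * a) * z ^ 2 / (T - t) ^ 2)).add
      (((h3.add h4).add_const ((-(2 * ab * z)) ^ 2)).const_mul (1 / 2))).congr_deriv ?_).deriv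
    simp only [id_eq, Pi.div_apply, Nat.reduceSub, pow_one]
    field_simp
    push_cast
    ring
  have hPz : cdz (fun t r z =>
        (-(1 / 2) * (a * (a + 1) * r ^ 2 / (T - t) ^ 2 + k ^ 2 / r ^ 2) +
            a * (1 - 2 * a) * z ^ 2 / (T - t) ^ 2) +
          (1 / 2) * ((ab * r) ^ 2 + (2 * k * ab * (T - t) / ((2 * a + 1) * r)) ^ 2 +
            (-(2 * ab * z)) ^ 2)) t r z =
      2 * a * (1 - 2 * a) * z / (T - t) ^ 2 + 4 * ab ^ 2 * z := by
    have h1 := ((hasDerivAt_pow 2 z).const_mul (a * (1 - 2 * a))).div_const ((T - t) ^ 2)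
    have h2 := (((hasDerivAt_id z).const_mul (2 * ab)).neg).pow 2
    refine ((((h1.const_add
      (-(1 / 2) * (a * (a + 1) * r ^ 2 / (T - t) ^ 2 + k ^ 2 / r ^ 2))).add
      ((h2.const_add
        ((ab * r) ^ 2 + (2 * k * ab * (T - t) / ((2 * a + 1) * r)) ^ 2)).const_mul
          (1 / 2)))).congr_deriv ?_).deriv
    simp only [id, Pi.neg_apply]
    field_simp
    push_cast
    ring
  have tvr : cdt (fun t r _ => a / (T - t) * r) t r z = a / (T - t) ^ 2 * r :=
    ((hasDerivAt_div_sub T a hτ).mul_const r).deriv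
  have tvz : cdt (fun t _ z => -2 * a / (T - t) * z) t r z = -2 * a / (T - t) ^ 2 * z :=
    ((hasDerivAt_div_sub T (-2 * a) hτ).mul_const z).deriv
  have tHθ : cdt (fun t r _ => 2 * k * ab / (2 * a + 1) * (T - t) / r) t r z =
      -(2 * k * ab / (2 * a + 1)) / r := by
    refine (((((hasDerivAt_id t).const_sub T).const_mul
      (2 * k * ab / (2 * a + 1))).div_const r).congr_deriv ?_).deriv
    ring
  have tconst (f : ℝ → ℝ → ℝ) : cdt (fun _ r z => f r z) t r z = 0 := by simp [cdt]
  have tvθ := tconst fun r _ => k / r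
  have tHr := tconst fun r _ => ab * r
  have tHz := tconst fun _ z => -2 * ab * z
  have divfree (g : ℝ → ℝ) :
      cdr (fun t r _ => r * (g t * r)) t r z = 2 * g t * r := by
    refine (((hasDerivAt_id r).mul ((hasDerivAt_id r).const_mul (g t))).congr_deriv ?_).deriv
    simp only [id]
    ring
  have divfree' (g : ℝ → ℝ) :
      cdz (fun t r z => r * (g t * z)) t r z = r * g t := by
    refine ((((hasDerivAt_id z).const_mul (g t)).const_mul r).congr_deriv ?_).deriv
    ring
  rw [evr, evz, eHθ, eHz, AxiMHD, hPr, hPz, tvr, tvz, tHθ, tvθ, tHr, tHz,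
    alap_mul_radius fun t => a / (T - t), alap_mul_radius fun _ => ab,
    alap_div_radius (fun _ => k) t z hr',
    alap_div_radius (fun t => 2 * k * ab / (2 * a + 1) * (T - t)) t z hr',
    alap_mul_height fun t => -2 * a / (T - t), alap_mul_height fun _ => -2 * ab,
    cdr_mul_radius fun t => a / (T - t), cdr_mul_radius fun _ => ab,
    cdr_div_radius fun _ => k, cdr_div_radius fun t => 2 * k * ab / (2 * a + 1) * (T - t),
    cdz_mul_height fun t => -2 * a / (T - t), cdz_mul_height fun _ => -2 * ab,
    cdr_of_radius_independent fun t z => -2 * a / (T - t) * z,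
    cdr_of_radius_independent fun _ z => -2 * ab * z,
    cdz_of_height_independent fun t r => a / (T - t) * r,
    cdz_of_height_independent fun _ r => ab * r,
    cdz_of_height_independent fun _ r => k / r,
    cdz_of_height_independent fun t r => 2 * k * ab / (2 * a + 1) * (T - t) / r,
    divfree fun t => a / (T - t), divfree fun _ => ab,
    divfree' fun t => -2 * a / (T - t), divfree' fun _ => -2 * ab]
  simp only [Pi.zero_apply]
  refine ⟨?_, ?_, ?_, ?_, ?_, ?_, ?_, ?_⟩ <;> field_simp <;> ring
end
end
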